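/- Safe optimality: consider a balanced MDP, let α ∈ (0,1), and let Q₁^safe be the unique fixed point of T^safe_α. Then for all (x,a) ∈ X×A, Q₁^safe(x,a) = sup_{π∈Π} Q₁^π(x,a), where Q₁^π is the first component of the unique fixed point 𝒬^π = (Q₁^π, Q₂^π) of the diatomic Bellman operator T^π_α; equivalently, setting Q₂^safe(x,a) = (V^*(x) − αQ₁^safe(x,a))/(1−α), one has Q₂^safe(x,a) = inf_{π∈Π} Q₂^π(x,a). -/

import Mathlib

open MeasureTheory ProbabilityTheory Finset Set

noncomputable section

/-- Quantile (generalized inverse distribution) function of a measure on `ℝ`. -/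
def quantileFn (ν : Measure ℝ) (τ : ℝ) : ℝ :=
  sInf {z : ℝ | τ ≤ cdf ν z}

/-- Left average value-at-risk at level `α`. -/
def avarLeft (α : ℝ) (ν : Measure ℝ) : ℝ :=
  (1 / α) * ∫ τ in (0:ℝ)..α, quantileFn ν τ

/-- Right average value-at-risk at level `1 - α`. -/
def avarRight (α : ℝ) (ν : Measure ℝ) : ℝ :=
  (1 / (1 - α)) * ∫ τ in α..(1:ℝ), quantileFn ν τ

/-- A measure on `ℝ` with bounded support. -/
def HasBoundedSupport (ν : Measure ℝ) : Prop :=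
  ∃ a b : ℝ, ν (Set.Icc a b)ᶜ = 0

/-- Finite Markov decision process with fixed state and action spaces. -/
structure MDP (X A : Type) [Fintype X] [Fintype A] where
  P : X → A → X → ℝ
  r : X → A → X → ℝ
  γ : ℝ
  P_nonneg : ∀ x a x', 0 ≤ P x a x'
  P_sum_one : ∀ x a, ∑ x', P x a x' = 1
  γ_nonneg : 0 ≤ γ
  γ_lt_one : γ < 1

variable {X A : Type} [Fintype X] [Fintype A]

/-- A stationary Markovian policy. -/
def IsPolicy (π : X → A → ℝ) : Prop :=
  (∀ x a, 0 ≤ π x a) ∧ ∀ x, ∑ a, π x a = 1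

/-- The discrete measure `(T^π D_{α,Q})^{(x,a)}`. -/
def diatomicMeasure (M : MDP X A) (α : ℝ) (π : X → A → ℝ)
    (Q : X → A → ℝ × ℝ) (x : X) (a : A) : Measure ℝ :=
  ∑ x' : X, ∑ a' : A, ENNReal.ofReal (M.P x a x' * π x' a') •
    (ENNReal.ofReal α • Measure.dirac (M.r x a x' + M.γ * (Q x' a').1)
      + ENNReal.ofReal (1 - α) • Measure.dirac (M.r x a x' + M.γ * (Q x' a').2))

/-- The diatomic Bellman operator `T^π_α`. -/
def diatomicT (M : MDP X A) (α : ℝ) (π : X → A → ℝ)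
    (Q : X → A → ℝ × ℝ) : X → A → ℝ × ℝ :=
  fun x a => (avarLeft α (diatomicMeasure M α π Q x a),
              avarRight α (diatomicMeasure M α π Q x a))

variable [Nonempty A]

/-- The second component `Q₂` determined by `Q₁` in a balanced MDP. -/
def Q2of (α : ℝ) (Vstar : X → ℝ) (Q1 : X → A → ℝ) : X → A → ℝ :=
  fun x a => (Vstar x - α * Q1 x a) / (1 - α)

/-- The MDP is balanced: `Q^*(x,a) = V^*(x)` for all `(x,a)`, i.e. `V^*` solves the
Bellman optimality equation with all actions optimal. -/
def IsBalanced (M : MDP X A) (Vstar : X → ℝ) : Prop :=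
  ∀ x a, Vstar x = ∑ x', M.P x a x' * (M.r x a x' + M.γ * Vstar x')

/-- The discrete measure appearing in the safe Bellman operator. -/
def safeMeasure (M : MDP X A) (α : ℝ) (Vstar : X → ℝ) (Q1 : X → A → ℝ)
    (x : X) (a : A) : Measure ℝ :=
  ∑ x' : X, ENNReal.ofReal (M.P x a x') •
    (ENNReal.ofReal α • Measure.dirac (M.r x a x' + M.γ * ⨆ a', Q1 x' a')
      + ENNReal.ofReal (1 - α) •
          Measure.dirac (M.r x a x' + M.γ * ⨅ a', Q2of α Vstar Q1 x' a'))

/-- The discrete measure appearing in the risky Bellman operator. -/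
def riskyMeasure (M : MDP X A) (α : ℝ) (Vstar : X → ℝ) (Q1 : X → A → ℝ)
    (x : X) (a : A) : Measure ℝ :=
  ∑ x' : X, ENNReal.ofReal (M.P x a x') •
    (ENNReal.ofReal α • Measure.dirac (M.r x a x' + M.γ * ⨅ a', Q1 x' a')
      + ENNReal.ofReal (1 - α) •
          Measure.dirac (M.r x a x' + M.γ * ⨆ a', Q2of α Vstar Q1 x' a'))

/-- The safe Bellman operator `T^safe_α`. -/
def Tsafe (M : MDP X A) (α : ℝ) (Vstar : X → ℝ) (Q1 : X → A → ℝ) : X → A → ℝ :=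
  fun x a => avarLeft α (safeMeasure M α Vstar Q1 x a)

/-- The risky Bellman operator `T^risky_α`. -/
def Trisky (M : MDP X A) (α : ℝ) (Vstar : X → ℝ) (Q1 : X → A → ℝ) : X → A → ℝ :=
  fun x a => avarLeft α (riskyMeasure M α Vstar Q1 x a)

section Quantile

variable (ν : Measure ℝ)

theorem exists_le_cdf {τ : ℝ} (hτ : τ < 1) : ∃ z, τ ≤ cdf ν z :=
  (((tendsto_cdf_atTop ν).eventually_const_lt hτ).mono fun _ h => h.le).exists

theorem bddBelow_le_cdf {τ : ℝ} (hτ : 0 < τ) : BddBelow {z : ℝ | τ ≤ cdf ν z} := by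
  obtain ⟨b, hb⟩ := ((tendsto_cdf_atBot ν).eventually_lt_const hτ).exists
  refine ⟨b, fun z hz => ?_⟩
  by_contra! h
  exact absurd (hz.trans (monotone_cdf ν h.le)) (not_le.2 hb)

theorem quantileFn_le_iff {τ : ℝ} (hτ : τ ∈ Ioo (0:ℝ) 1) (z : ℝ) :
    quantileFn ν τ ≤ z ↔ τ ≤ cdf ν z := by
  refine ⟨fun h => ?_, fun h => csInf_le (bddBelow_le_cdf ν hτ.1) h⟩
  by_contra! hlt
  have hev : ∀ᶠ y in nhdsWithin z (Ioi z), cdf ν y < τ :=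
    (((cdf ν).right_continuous z).mono Ioi_subset_Ici_self).eventually_lt_const hlt
  obtain ⟨y, hy, hzy⟩ := (hev.and self_mem_nhdsWithin).exists
  have : y ≤ quantileFn ν τ := by
    refine le_csInf (exists_le_cdf ν hτ.2) fun w hw => ?_
    by_contra! hwy
    exact absurd (le_trans hw (monotone_cdf ν hwy.le)) (not_le.2 hy)
  exact absurd (this.trans h) (not_le.2 hzy)

theorem monotoneOn_quantileFn : MonotoneOn (quantileFn ν) (Ioo (0:ℝ) 1) := by
  intro s hs t ht hst
  rw [quantileFn_le_iff ν hs]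
  exact hst.trans ((quantileFn_le_iff ν ht _).1 le_rfl)

theorem aemeasurable_quantileFn : AEMeasurable (quantileFn ν) (volume.restrict (Ioo (0:ℝ) 1)) :=
  aemeasurable_restrict_of_monotoneOn measurableSet_Ioo (monotoneOn_quantileFn ν)

theorem map_quantileFn [IsProbabilityMeasure ν] : (volume.restrict (Ioo (0:ℝ) 1)).map (quantileFn ν) = ν := by
  symm
  refine Measure.ext_of_Iic _ _ fun z => ?_
  rw [Measure.map_apply_of_aemeasurable (aemeasurable_quantileFn ν) measurableSet_Iic,
    Measure.restrict_apply' measurableSet_Ioo]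
  have h : quantileFn ν ⁻¹' Iic z ∩ Ioo 0 1 = Iic (cdf ν z) ∩ Ioo 0 1 := by
    ext τ
    simp only [Set.mem_inter_iff, Set.mem_preimage, Set.mem_Iic, and_congr_left_iff]
    exact fun hτ => quantileFn_le_iff ν hτ z
  have h' : volume (Iic (cdf ν z) ∩ Ioo 0 1) = volume (Ioc 0 (cdf ν z)) := by
    rw [measure_congr ((Filter.EventuallyEq.refl _ (Iic (cdf ν z))).inter
      (Ioo_ae_eq_Ioc (a := (0:ℝ)) (b := 1)))]
    congr 1
    ext τ
    simp only [Set.mem_inter_iff, Set.mem_Iic, Set.mem_Ioc]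
    have := cdf_le_one ν z
    constructor
    · rintro ⟨a, b, c⟩; exact ⟨b, a⟩
    · rintro ⟨a, b⟩; exact ⟨b, a, b.trans this⟩
  rw [h, h', Real.volume_Ioc, sub_zero, ofReal_cdf]

theorem intervalIntegral_comp_quantileFn [IsProbabilityMeasure ν] (f : ℝ → ℝ) (hf : Continuous f) :
    ∫ τ in (0:ℝ)..1, f (quantileFn ν τ) = ∫ z, f z ∂ν := by
  rw [intervalIntegral.integral_of_le zero_le_one, integral_Ioc_eq_integral_Ioo]
  conv_rhs => rw [← map_quantileFn ν]
  rw [integral_map (aemeasurable_quantileFn ν) hf.aestronglyMeasurable]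

theorem intervalIntegrable_comp_quantileFn [IsProbabilityMeasure ν] {f : ℝ → ℝ} (hf : Integrable f ν) :
    IntervalIntegrable (fun τ => f (quantileFn ν τ)) volume 0 1 := by
  rw [intervalIntegrable_iff_integrableOn_Ioo_of_le zero_le_one]
  rw [← map_quantileFn ν] at hf
  exact hf.comp_aemeasurable (aemeasurable_quantileFn ν)

theorem avarLeft_add_avarRight [IsProbabilityMeasure ν] {α : ℝ} (hα : α ∈ Ioo (0:ℝ) 1)
    (hν : Integrable (fun z => z) ν) :
    α * avarLeft α ν + (1 - α) * avarRight α ν = ∫ z, z ∂ν := by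
  have h1 := intervalIntegrable_comp_quantileFn ν hν
  have h0 : α ≠ 0 := hα.1.ne'
  have h0' : 1 - α ≠ 0 := (sub_pos.2 hα.2).ne'
  have hm : α ∈ Set.uIcc (0:ℝ) 1 := by
    rw [Set.uIcc_of_le zero_le_one]; exact Ioo_subset_Icc_self hα
  rw [← intervalIntegral_comp_quantileFn ν (fun z => z) continuous_id,
    ← intervalIntegral.integral_add_adjacent_intervals (b := α)
      (h1.mono_set (Set.uIcc_subset_uIcc_left hm)) (h1.mono_set (Set.uIcc_subset_uIcc_right hm)),
    avarLeft, avarRight]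
  field_simp

/-- Rockafellar–Uryasev representation of the left average value-at-risk. -/
theorem isGreatest_avarLeft [IsProbabilityMeasure ν] {α : ℝ} (hα : α ∈ Ioo (0:ℝ) 1)
    (hν : Integrable (fun z => z) ν) :
    IsGreatest (Set.range fun t => α * t - ∫ z, max (t - z) 0 ∂ν) (α * avarLeft α ν) := by
  have hI (t : ℝ) : Integrable (fun z => max (t - z) 0) ν :=
    ((integrable_const t).sub hν).pos_part
  have hq := intervalIntegrable_comp_quantileFn ν hν
  have hm : α ∈ Set.uIcc (0:ℝ) 1 := by
    rw [Set.uIcc_of_le zero_le_one]; exact Ioo_subset_Icc_self hα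
  have hql : IntervalIntegrable (quantileFn ν) volume 0 α :=
    hq.mono_set (Set.uIcc_subset_uIcc_left hm)
  have ha : α * avarLeft α ν = ∫ τ in (0:ℝ)..α, quantileFn ν τ := by
    have h0 : α ≠ 0 := hα.1.ne'
    rw [avarLeft]; field_simp
  have hs (t : ℝ) : ∫ z, max (t - z) 0 ∂ν = (∫ τ in (0:ℝ)..α, max (t - quantileFn ν τ) 0) +
      ∫ τ in α..1, max (t - quantileFn ν τ) 0 := by
    have h := intervalIntegrable_comp_quantileFn ν (hI t)
    rw [← intervalIntegral_comp_quantileFn ν (fun z => max (t - z) 0) (by fun_prop),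
      intervalIntegral.integral_add_adjacent_intervals
        (h.mono_set (Set.uIcc_subset_uIcc_left hm)) (h.mono_set (Set.uIcc_subset_uIcc_right hm))]
  have hl (t : ℝ) : ∫ τ in (0:ℝ)..α, (t - quantileFn ν τ) =
      α * t - ∫ τ in (0:ℝ)..α, quantileFn ν τ := by
    rw [intervalIntegral.integral_sub (by simp) hql]; simp
  constructor
  · refine ⟨quantileFn ν α, ?_⟩
    have e1 : ∫ τ in (0:ℝ)..α, max (quantileFn ν α - quantileFn ν τ) 0 =
        ∫ τ in (0:ℝ)..α, (quantileFn ν α - quantileFn ν τ) := by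
      refine intervalIntegral.integral_congr_ae (Filter.Eventually.of_forall fun τ hτ => ?_)
      rw [Set.uIoc_of_le hα.1.le] at hτ
      exact max_eq_left (sub_nonneg.2
        (monotoneOn_quantileFn ν ⟨hτ.1, hτ.2.trans_lt hα.2⟩ hα hτ.2))
    have e2 : ∫ τ in α..1, max (quantileFn ν α - quantileFn ν τ) 0 = 0 := by
      rw [intervalIntegral.integral_of_le hα.2.le, integral_Ioc_eq_integral_Ioo]
      refine setIntegral_eq_zero_of_forall_eq_zero fun τ hτ => ?_
      exact max_eq_right (sub_nonpos.2
        (monotoneOn_quantileFn ν hα ⟨hα.1.trans hτ.1, hτ.2⟩ hτ.1.le))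
    simp only [hs, e1, e2, hl, ha]
    ring
  · rintro _ ⟨t, rfl⟩
    have h1 : ∫ τ in (0:ℝ)..α, (t - quantileFn ν τ) ≤
        ∫ τ in (0:ℝ)..α, max (t - quantileFn ν τ) 0 := by
      refine intervalIntegral.integral_mono hα.1.le (intervalIntegrable_const.sub hql) ?_
        fun τ => le_max_left _ _
      exact (intervalIntegrable_comp_quantileFn ν (hI t)).mono_set (Set.uIcc_subset_uIcc_left hm)
    have h2 : 0 ≤ ∫ τ in α..1, max (t - quantileFn ν τ) 0 :=
      intervalIntegral.integral_nonneg hα.2.le fun _ _ => le_max_right _ _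
    rw [hl] at h1
    simp only [hs, ha]
    linarith

theorem avarLeft_le_integral [IsProbabilityMeasure ν] {α : ℝ} (hα : α ∈ Ioo (0:ℝ) 1)
    (hν : Integrable (fun z => z) ν) : avarLeft α ν ≤ ∫ z, z ∂ν := by
  obtain ⟨t, ht⟩ := (isGreatest_avarLeft ν hα hν).1
  have hsub : ∫ z, (t - z) ∂ν = t - ∫ z, z ∂ν := by
    rw [integral_sub (integrable_const t) hν]; simp
  have h1 : t - ∫ z, z ∂ν ≤ ∫ z, max (t - z) 0 ∂ν := by
    rw [← hsub]
    exact integral_mono ((integrable_const t).sub hν) ((integrable_const t).sub hν).pos_part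
      fun z => le_max_left _ _
  have h2 : 0 ≤ ∫ z, max (t - z) 0 ∂ν := integral_nonneg fun z => le_max_right _ _
  simp only at ht
  obtain ⟨h0, h1'⟩ := hα
  nlinarith

end Quantile

section DiatomicMeasure

theorem integrable_diatomicMeasure (M : MDP X A) (α : ℝ) (π : X → A → ℝ)
    (Q : X → A → ℝ × ℝ) (x : X) (a : A) (f : ℝ → ℝ) :
    Integrable f (diatomicMeasure M α π Q x a) := by
  simp only [diatomicMeasure, integrable_finsetSum_measure]
  intro x' _ a' _
  exact (((integrable_dirac (by simp)).smul_measure ENNReal.ofReal_ne_top).add_measure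
    ((integrable_dirac (by simp)).smul_measure ENNReal.ofReal_ne_top)).smul_measure
      ENNReal.ofReal_ne_top

theorem integral_diatomicMeasure (M : MDP X A) {α : ℝ} (hα : α ∈ Ioo (0:ℝ) 1)
    {π : X → A → ℝ} (hπ : IsPolicy π) (Q : X → A → ℝ × ℝ) (x : X) (a : A) (f : ℝ → ℝ) :
    ∫ z, f z ∂diatomicMeasure M α π Q x a = ∑ x', ∑ a', M.P x a x' * π x' a' *
      (α * f (M.r x a x' + M.γ * (Q x' a').1) + (1 - α) * f (M.r x a x' + M.γ * (Q x' a').2)) := by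
  have hI (c z : ℝ) : Integrable f (ENNReal.ofReal c • Measure.dirac z) :=
    (integrable_dirac (by simp)).smul_measure ENNReal.ofReal_ne_top
  have hI' (x' : X) (a' : A) : Integrable f (ENNReal.ofReal (M.P x a x' * π x' a') •
      (ENNReal.ofReal α • Measure.dirac (M.r x a x' + M.γ * (Q x' a').1)
        + ENNReal.ofReal (1 - α) • Measure.dirac (M.r x a x' + M.γ * (Q x' a').2))) :=
    ((hI _ _).add_measure (hI _ _)).smul_measure ENNReal.ofReal_ne_top
  rw [diatomicMeasure, integral_finsetSum_measure fun x' _ =>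
    integrable_finsetSum_measure.2 fun a' _ => hI' x' a']
  refine Finset.sum_congr rfl fun x' _ => ?_
  rw [integral_finsetSum_measure fun a' _ => hI' x' a']
  refine Finset.sum_congr rfl fun a' _ => ?_
  rw [integral_smul_measure, integral_add_measure (hI _ _) (hI _ _), integral_smul_measure,
    integral_smul_measure, integral_dirac, integral_dirac,
    ENNReal.toReal_ofReal (mul_nonneg (M.P_nonneg x a x') (hπ.1 x' a')),
    ENNReal.toReal_ofReal hα.1.le, ENNReal.toReal_ofReal (sub_pos.2 hα.2).le]
  simp only [smul_eq_mul]

theorem sum_transition_mul_policy (M : MDP X A) {π : X → A → ℝ} (hπ : IsPolicy π)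
    (x : X) (a : A) (f : X → ℝ) :
    ∑ x', ∑ a', M.P x a x' * π x' a' * f x' = ∑ x', M.P x a x' * f x' := by
  refine Finset.sum_congr rfl fun x' _ => ?_
  rw [← Finset.sum_mul, ← Finset.mul_sum, hπ.2 x', mul_one]

theorem isProbabilityMeasure_diatomicMeasure (M : MDP X A) {α : ℝ} (hα : α ∈ Ioo (0:ℝ) 1)
    {π : X → A → ℝ} (hπ : IsPolicy π) (Q : X → A → ℝ × ℝ) (x : X) (a : A) :
    IsProbabilityMeasure (diatomicMeasure M α π Q x a) := by
  have hα1 : ENNReal.ofReal α + ENNReal.ofReal (1 - α) = 1 := by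
    rw [← ENNReal.ofReal_add hα.1.le (sub_pos.2 hα.2).le]; simp
  have hnn (x' : X) (a' : A) : 0 ≤ M.P x a x' * π x' a' :=
    mul_nonneg (M.P_nonneg x a x') (hπ.1 x' a')
  have hsum := sum_transition_mul_policy M hπ x a fun _ => 1
  simp only [mul_one, M.P_sum_one] at hsum
  constructor
  simp only [diatomicMeasure, Measure.finsetSum_apply, Measure.smul_apply, Measure.add_apply,
    measure_univ, smul_eq_mul, mul_one, hα1]
  rw [← ENNReal.ofReal_one, ← hsum,
    ENNReal.ofReal_sum_of_nonneg fun x' _ => Finset.sum_nonneg fun a' _ => hnn x' a']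
  exact Finset.sum_congr rfl fun x' _ =>
    (ENNReal.ofReal_sum_of_nonneg fun a' _ => hnn x' a').symm

end DiatomicMeasure

/-- Expected shortfall below `u` of the two-point distribution on `γ q` and `γ q'`, with
weights `α` and `1 - α`, where `q'` is chosen so that `q` and `q'` have mean `v`. -/
def twoPointShortfall (α γ v u q : ℝ) : ℝ :=
  α * max (u - γ * q) 0 + (1 - α) * max (u - γ * ((v - α * q) / (1 - α))) 0

theorem twoPointShortfall_anti {α γ v u q q' : ℝ} (hα : α ∈ Ioo (0:ℝ) 1) (hγ : 0 ≤ γ)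
    (hq : q ≤ q') (hv : q' ≤ v) :
    twoPointShortfall α γ v u q' ≤ twoPointShortfall α γ v u q := by
  obtain ⟨h0, h1⟩ := hα
  have h1' : 0 < 1 - α := sub_pos.2 h1
  have hmean (s : ℝ) : α * (u - γ * s) + (1 - α) * (u - γ * ((v - α * s) / (1 - α))) =
      u - γ * v := by
    field_simp; ring
  have hx : u - γ * q' ≤ u - γ * q := by gcongr
  have hy : u - γ * ((v - α * q) / (1 - α)) ≤ u - γ * ((v - α * q') / (1 - α)) := by gcongr
  have hm := hmean q
  have hm' := hmean q'
  have hxv : u - γ * v ≤ u - γ * q' := by gcongr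
  unfold twoPointShortfall
  generalize u - γ * q' = x' at *
  generalize u - γ * q = x at *
  generalize u - γ * ((v - α * q) / (1 - α)) = y at *
  generalize u - γ * ((v - α * q') / (1 - α)) = y' at *
  rcases le_total y' 0 with hy0 | hy0
  · rw [max_eq_right hy0, max_eq_right (hy.trans hy0)]
    gcongr
  · have : 0 ≤ x' := by nlinarith
    rw [max_eq_left hy0, max_eq_left this, hm', ← hm]
    gcongr <;> exact le_max_left _ _

theorem twoPointShortfall_le_add {α γ v u q q' c : ℝ} (hα : α ∈ Ioo (0:ℝ) 1) (hγ : 0 ≤ γ)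
    (hc : 0 ≤ c) (hv : q' ≤ v) (hq : q ≤ q' + c) :
    twoPointShortfall α γ v u q' ≤ twoPointShortfall α γ v u q + α * γ * c := by
  have hc' : 0 ≤ α * γ * c := mul_nonneg (mul_nonneg hα.1.le hγ) hc
  rcases le_total q q' with h | h
  · linarith [twoPointShortfall_anti (u := u) hα hγ h hv]
  · have h1' : 0 < 1 - α := sub_pos.2 hα.2
    have h1 : max (u - γ * q') 0 ≤ max (u - γ * q) 0 + γ * c := by
      have := mul_le_mul_of_nonneg_left hq hγ
      have := mul_nonneg hγ hc
      refine max_le ?_ ?_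
      · linarith [le_max_left (u - γ * q) 0]
      · linarith [le_max_right (u - γ * q) 0]
    have h2 : u - γ * ((v - α * q') / (1 - α)) ≤ u - γ * ((v - α * q) / (1 - α)) := by
      have := hα.1
      gcongr
    have h3 : (1 - α) * max (u - γ * ((v - α * q') / (1 - α))) 0 ≤
        (1 - α) * max (u - γ * ((v - α * q) / (1 - α))) 0 := by gcongr
    have h4 := mul_le_mul_of_nonneg_left h1 hα.1.le
    unfold twoPointShortfall
    linarith

/-- A function that every nonnegative upper bound `d` bounds by `γ d` is nonpositive. -/
theorem nonpos_of_forall_le_mul {ι : Type*} [Finite ι] {γ : ℝ} (hγ : γ < 1) (f : ι → ℝ)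
    (h : ∀ d, 0 ≤ d → (∀ i, f i ≤ d) → ∀ i, f i ≤ γ * d) (i : ι) : f i ≤ 0 := by
  have : Nonempty ι := ⟨i⟩
  obtain ⟨p, hp⟩ := Finite.exists_max f
  refine (hp i).trans ?_
  by_contra! hpos
  have := h (f p) hpos.le hp p
  nlinarith

section FixedPoint

theorem isGreatest_avarLeft_diatomicMeasure (M : MDP X A) {α : ℝ} (hα : α ∈ Ioo (0:ℝ) 1)
    {π : X → A → ℝ} (hπ : IsPolicy π) (V : X → ℝ) {Q : X → A → ℝ × ℝ}
    (hQ : ∀ x a, (Q x a).2 = (V x - α * (Q x a).1) / (1 - α)) (x : X) (a : A) :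
    IsGreatest (Set.range fun t => α * t - ∑ x', ∑ a', M.P x a x' * π x' a' *
        twoPointShortfall α M.γ (V x') (t - M.r x a x') (Q x' a').1)
      (α * avarLeft α (diatomicMeasure M α π Q x a)) := by
  have := isProbabilityMeasure_diatomicMeasure M hα hπ Q x a
  have h := isGreatest_avarLeft _ hα (integrable_diatomicMeasure M α π Q x a fun z => z)
  simpa only [integral_diatomicMeasure M hα hπ, ← sub_sub, hQ, twoPointShortfall] using h

theorem integral_id_diatomicMeasure (M : MDP X A) {α : ℝ} (hα : α ∈ Ioo (0:ℝ) 1)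
    {π : X → A → ℝ} (hπ : IsPolicy π) {V : X → ℝ} (hV : IsBalanced M V) {Q : X → A → ℝ × ℝ}
    (hQ : ∀ x a, (Q x a).2 = (V x - α * (Q x a).1) / (1 - α)) (x : X) (a : A) :
    ∫ z, z ∂diatomicMeasure M α π Q x a = V x := by
  have h1' : 1 - α ≠ 0 := (sub_pos.2 hα.2).ne'
  rw [integral_diatomicMeasure M hα hπ Q x a fun z => z, hV x a,
    ← sum_transition_mul_policy M hπ x a fun x' => M.r x a x' + M.γ * V x']
  refine Finset.sum_congr rfl fun x' _ => Finset.sum_congr rfl fun a' _ => ?_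
  rw [hQ]
  field_simp
  ring

theorem avarLeft_diatomicMeasure_le (M : MDP X A) {α : ℝ} (hα : α ∈ Ioo (0:ℝ) 1)
    {π : X → A → ℝ} (hπ : IsPolicy π) {V : X → ℝ} (hV : IsBalanced M V) {Q : X → A → ℝ × ℝ}
    (hQ : ∀ x a, (Q x a).2 = (V x - α * (Q x a).1) / (1 - α)) (x : X) (a : A) :
    avarLeft α (diatomicMeasure M α π Q x a) ≤ V x := by
  have := isProbabilityMeasure_diatomicMeasure M hα hπ Q x a
  rw [← integral_id_diatomicMeasure M hα hπ hV hQ x a]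
  exact avarLeft_le_integral _ hα (integrable_diatomicMeasure M α π Q x a _)

theorem diatomicT_snd (M : MDP X A) {α : ℝ} (hα : α ∈ Ioo (0:ℝ) 1)
    {π : X → A → ℝ} (hπ : IsPolicy π) {V : X → ℝ} (hV : IsBalanced M V) {Q : X → A → ℝ × ℝ}
    (hQ : ∀ x a, (Q x a).2 = (V x - α * (Q x a).1) / (1 - α)) (x : X) (a : A) :
    (diatomicT M α π Q x a).2 = (V x - α * (diatomicT M α π Q x a).1) / (1 - α) := by
  have := isProbabilityMeasure_diatomicMeasure M hα hπ Q x a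
  have h := avarLeft_add_avarRight _ hα (integrable_diatomicMeasure M α π Q x a fun z => z)
  rw [integral_id_diatomicMeasure M hα hπ hV hQ x a] at h
  rw [eq_div_iff (sub_pos.2 hα.2).ne']
  simp only [diatomicT]
  linarith

theorem snd_eq_of_diatomicT_eq (M : MDP X A) {α : ℝ} (hα : α ∈ Ioo (0:ℝ) 1)
    {π : X → A → ℝ} (hπ : IsPolicy π) {V : X → ℝ} (hV : IsBalanced M V) {Q : X → A → ℝ × ℝ}
    (hfix : diatomicT M α π Q = Q) (x : X) (a : A) :
    (Q x a).2 = (V x - α * (Q x a).1) / (1 - α) := by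
  set e : X × A → ℝ := fun p => α * (Q p.1 p.2).1 + (1 - α) * (Q p.1 p.2).2 - V p.1 with he
  have hnn (x a x' a') : 0 ≤ M.P x a x' * π x' a' := mul_nonneg (M.P_nonneg x a x') (hπ.1 x' a')
  have hstep (x : X) (a : A) :
      e (x, a) = ∑ x', ∑ a', M.P x a x' * π x' a' * (M.γ * e (x', a')) := by
    have := isProbabilityMeasure_diatomicMeasure M hα hπ Q x a
    have h := avarLeft_add_avarRight _ hα (integrable_diatomicMeasure M α π Q x a fun z => z)
    rw [integral_diatomicMeasure M hα hπ Q x a fun z => z] at h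
    have hl : avarLeft α (diatomicMeasure M α π Q x a) = (Q x a).1 :=
      congrArg (fun F => (F x a).1) hfix
    have hr : avarRight α (diatomicMeasure M α π Q x a) = (Q x a).2 :=
      congrArg (fun F => (F x a).2) hfix
    rw [hl, hr] at h
    simp only [he]
    rw [h, hV x a, ← sum_transition_mul_policy M hπ x a fun x' => M.r x a x' + M.γ * V x',
      ← Finset.sum_sub_distrib]
    refine Finset.sum_congr rfl fun x' _ => ?_
    rw [← Finset.sum_sub_distrib]
    exact Finset.sum_congr rfl fun a' _ => by ring
  have hbound (x : X) (a : A) (g : X × A → ℝ) (d : ℝ) (hg : ∀ p, g p ≤ d) :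
      ∑ x', ∑ a', M.P x a x' * π x' a' * (M.γ * g (x', a')) ≤ M.γ * d := by
    have hd : ∑ x', ∑ a', M.P x a x' * π x' a' * (M.γ * d) = M.γ * d := by
      rw [sum_transition_mul_policy M hπ x a fun _ => M.γ * d, ← Finset.sum_mul, M.P_sum_one,
        one_mul]
    rw [← hd]
    exact Finset.sum_le_sum fun x' _ => Finset.sum_le_sum fun a' _ =>
      mul_le_mul_of_nonneg_left (mul_le_mul_of_nonneg_left (hg _) M.γ_nonneg) (hnn x a x' a')
  have hle := nonpos_of_forall_le_mul M.γ_lt_one e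
    (fun d _ hd p => (hstep p.1 p.2).trans_le (hbound p.1 p.2 e d hd)) (x, a)
  have hge := nonpos_of_forall_le_mul M.γ_lt_one (fun p => -e p)
    (fun d _ hd p => by
      refine le_of_eq_of_le ?_ (hbound p.1 p.2 (fun p => -e p) d hd)
      rw [← Prod.mk.eta (p := p), hstep]
      simp only [mul_neg, Finset.sum_neg_distrib]) (x, a)
  have h0 : e (x, a) = 0 := le_antisymm hle (by simpa using hge)
  rw [eq_div_iff (sub_pos.2 hα.2).ne']
  simp only [he] at h0
  linarith

open Classical in
/-- The deterministic policy choosing the action `g x` in state `x`. -/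
def deterministicPolicy (g : X → A) (x : X) (a : A) : ℝ := if a = g x then 1 else 0

theorem isPolicy_deterministicPolicy (g : X → A) : IsPolicy (deterministicPolicy g) := by
  classical
  refine ⟨fun x a => ?_, fun x => ?_⟩
  · unfold deterministicPolicy; split_ifs <;> norm_num
  · simp [deterministicPolicy]

/-- The first component of a fixed point of a deterministic policy that is greedy for it
dominates the first component of any other policy's fixed point. -/
theorem fst_le_of_diatomicT_eq (M : MDP X A) {α : ℝ} (hα : α ∈ Ioo (0:ℝ) 1)
    {V : X → ℝ} (hV : IsBalanced M V) {π : X → A → ℝ} (hπ : IsPolicy π)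
    {Q : X → A → ℝ × ℝ} (hfix : diatomicT M α π Q = Q) {g : X → A} {Q' : X → A → ℝ × ℝ}
    (hfix' : diatomicT M α (deterministicPolicy g) Q' = Q')
    (hg : ∀ x a, (Q' x a).1 ≤ (Q' x (g x)).1) (x : X) (a : A) :
    (Q x a).1 ≤ (Q' x a).1 := by
  classical
  have hπ' := isPolicy_deterministicPolicy g
  have hQ := snd_eq_of_diatomicT_eq M hα hπ hV hfix
  have hQ' := snd_eq_of_diatomicT_eq M hα hπ' hV hfix'
  have hfst (x : X) (a : A) : avarLeft α (diatomicMeasure M α π Q x a) = (Q x a).1 :=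
    congrArg (fun F => (F x a).1) hfix
  have hfst' (x : X) (a : A) :
      avarLeft α (diatomicMeasure M α (deterministicPolicy g) Q' x a) = (Q' x a).1 :=
    congrArg (fun F => (F x a).1) hfix'
  have hle' (x : X) (a : A) : (Q' x a).1 ≤ V x := by
    rw [← hfst']; exact avarLeft_diatomicMeasure_le M hα hπ' hV hQ' x a
  suffices h : ∀ p : X × A, (Q p.1 p.2).1 - (Q' p.1 p.2).1 ≤ 0 from sub_nonpos.1 (h (x, a))
  refine nonpos_of_forall_le_mul M.γ_lt_one _ fun d hd hf p => ?_
  obtain ⟨x, a⟩ := p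
  obtain ⟨t, ht⟩ := (isGreatest_avarLeft_diatomicMeasure M hα hπ V hQ x a).1
  have ht' := (isGreatest_avarLeft_diatomicMeasure M hα hπ' V hQ' x a).2 ⟨t, rfl⟩
  rw [hfst] at ht
  rw [hfst'] at ht'
  have hgreedy : ∑ x', ∑ a', M.P x a x' * deterministicPolicy g x' a' *
        twoPointShortfall α M.γ (V x') (t - M.r x a x') (Q' x' a').1 =
      ∑ x', ∑ a', M.P x a x' * π x' a' *
        twoPointShortfall α M.γ (V x') (t - M.r x a x') (Q' x' (g x')).1 := by
    rw [sum_transition_mul_policy M hπ x a fun x' =>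
      twoPointShortfall α M.γ (V x') (t - M.r x a x') (Q' x' (g x')).1]
    simp [deterministicPolicy]
  have hconst : ∑ x', ∑ a', M.P x a x' * π x' a' * (α * M.γ * d) = α * M.γ * d := by
    rw [sum_transition_mul_policy M hπ x a fun _ => α * M.γ * d, ← Finset.sum_mul,
      M.P_sum_one, one_mul]
  have hsum : ∑ x', ∑ a', M.P x a x' * π x' a' *
        twoPointShortfall α M.γ (V x') (t - M.r x a x') (Q' x' (g x')).1 ≤
      ∑ x', ∑ a', M.P x a x' * π x' a' *
        twoPointShortfall α M.γ (V x') (t - M.r x a x') (Q x' a').1 + α * M.γ * d := by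
    conv_rhs => rw [← hconst]
    simp only [← Finset.sum_add_distrib, ← mul_add]
    refine Finset.sum_le_sum fun x' _ => Finset.sum_le_sum fun a' _ =>
      mul_le_mul_of_nonneg_left ?_ (mul_nonneg (M.P_nonneg x a x') (hπ.1 x' a'))
    refine twoPointShortfall_le_add hα M.γ_nonneg hd (hle' _ _) ?_
    have := hf (x', a')
    simp only at this
    linarith [hg x' a']
  simp only at ht ht' ⊢
  rw [hgreedy] at ht'
  have : α * ((Q x a).1 - (Q' x a).1) ≤ α * (M.γ * d) := by linarith
  exact le_of_mul_le_mul_left this hα.1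

theorem safeMeasure_eq_diatomicMeasure (M : MDP X A) {α : ℝ} (hα : α ∈ Ioo (0:ℝ) 1)
    (V : X → ℝ) (Q1 : X → A → ℝ) {g : X → A} (hg : ∀ x a, Q1 x a ≤ Q1 x (g x))
    (x : X) (a : A) :
    safeMeasure M α V Q1 x a = diatomicMeasure M α (deterministicPolicy g)
      (fun x a => (Q1 x a, Q2of α V Q1 x a)) x a := by
  classical
  have hsup (x' : X) : ⨆ a', Q1 x' a' = Q1 x' (g x') :=
    le_antisymm (ciSup_le (hg x')) (le_ciSup (Set.finite_range _).bddAbove (g x'))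
  have hinf (x' : X) : ⨅ a', Q2of α V Q1 x' a' = Q2of α V Q1 x' (g x') := by
    refine le_antisymm (ciInf_le (Set.finite_range _).bddBelow (g x')) (le_ciInf fun a' => ?_)
    have h0 := hα.1
    have h1 : 0 < 1 - α := sub_pos.2 hα.2
    have := hg x' a'
    unfold Q2of
    gcongr
  simp only [safeMeasure, diatomicMeasure, hsup, hinf]
  refine Finset.sum_congr rfl fun x' _ => ?_
  rw [Finset.sum_eq_single (g x')]
  · simp [deterministicPolicy]
  · intro b _ hb
    simp [deterministicPolicy, hb]
  · simp

end FixedPoint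

theorem stmt17 (M : MDP X A) (α : ℝ) (hα : α ∈ Set.Ioo (0:ℝ) 1)
    (Vstar : X → ℝ) (hbal : IsBalanced M Vstar)
    (Q1safe : X → A → ℝ) (hfix : Tsafe M α Vstar Q1safe = Q1safe) :
    ∀ x a,
      IsLUB {q : ℝ | ∃ (π : X → A → ℝ) (Qpi : X → A → ℝ × ℝ),
          IsPolicy π ∧ diatomicT M α π Qpi = Qpi ∧ q = (Qpi x a).1}
        (Q1safe x a) ∧
      IsGLB {q : ℝ | ∃ (π : X → A → ℝ) (Qpi : X → A → ℝ × ℝ),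
          IsPolicy π ∧ diatomicT M α π Qpi = Qpi ∧ q = (Qpi x a).2}
        ((Vstar x - α * Q1safe x a) / (1 - α)) := by
  choose g hg using fun x => Finite.exists_max (Q1safe x)
  have hπ := isPolicy_deterministicPolicy g
  set Q : X → A → ℝ × ℝ := fun x a => (Q1safe x a, Q2of α Vstar Q1safe x a)
  have hQ : diatomicT M α (deterministicPolicy g) Q = Q := by
    have hfst (x : X) (a : A) :
        (diatomicT M α (deterministicPolicy g) Q x a).1 = Q1safe x a := by
      rw [← congrFun (congrFun hfix x) a, Tsafe, safeMeasure_eq_diatomicMeasure M hα Vstar _ hg]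
      rfl
    funext x a
    refine Prod.ext (hfst x a) ?_
    rw [diatomicT_snd M hα hπ hbal (fun _ _ => rfl), hfst]
    rfl
  have hle {π : X → A → ℝ} {Qpi : X → A → ℝ × ℝ} (hpi : IsPolicy π)
      (hfixpi : diatomicT M α π Qpi = Qpi) (x : X) (a : A) : (Qpi x a).1 ≤ Q1safe x a :=
    fst_le_of_diatomicT_eq M hα hbal hpi hfixpi hQ hg x a
  refine fun x a => ⟨IsGreatest.isLUB ⟨⟨_, Q, hπ, hQ, rfl⟩, ?_⟩,
    IsLeast.isGLB ⟨⟨_, Q, hπ, hQ, rfl⟩, ?_⟩⟩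
  · rintro _ ⟨π, Qpi, hpi, hfixpi, rfl⟩
    exact hle hpi hfixpi x a
  · rintro _ ⟨π, Qpi, hpi, hfixpi, rfl⟩
    rw [snd_eq_of_diatomicT_eq M hα hpi hbal hfixpi]
    have h0 := hα.1
    have h1 : 0 < 1 - α := sub_pos.2 hα.2
    have := hle hpi hfixpi x a
    gcongr

end
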